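/- Let F be a field of characteristic 0, B = (−1,−1)_F-type situation with F = ℝ: the quaternion division algebra D = (−1,−1)_ℝ over ℝ, and let K be the function field of the projective real conic x² + y² + z² = 0. Then ℝ is algebraically closed in K, K splits D, there exists a derivation δ on K with Const(δ) = ℝ, and there exists an A-polynomial f ∈ K[t;δ] of degree 2 such that S_f = K[t;δ]/K[t;δ]f = K ⊕ Kt is an infinite-dimensional unital nonassociative ℝ-algebra with right nucleus isomorphic to (−1,−1)_ℝ and left and middle nuclei equal to K. -/

import Mathlib

open scoped TensorProduct

/-! ## A framework for differential polynomial rings `K[t;δ]` and Petit algebras `S_f`. -/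

/-- A derivation on a field `K`: an additive map satisfying the Leibniz rule. -/
structure Der (K : Type) [Field K] where
  toFun : K → K
  map_add' : ∀ a b : K, toFun (a + b) = toFun a + toFun b
  leibniz' : ∀ a b : K, toFun (a * b) = a * toFun b + toFun a * b

/-- `F` (given as a subfield of `K` via `algebraMap F K`) is precisely the field of
constants `Const(δ) = {a ∈ K | δ(a) = 0}` of the derivation `δ`. -/
def Der.HasConstants {K : Type} [Field K] (δ : Der K) (F : Type) [Field F]
    [Algebra F K] : Prop :=
  ∀ a : K, δ.toFun a = 0 ↔ ∃ c : F, algebraMap F K c = a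

/-- The map `V_p(b) = b^p + δ^{p-1}(b)`. -/
def Der.Vp {K : Type} [Field K] (δ : Der K) (p : ℕ) (b : K) : K :=
  b ^ p + δ.toFun^[p - 1] b

/-- The `e`-fold iterate `V_{p^e}` of `V_p`. -/
def Der.VpIter {K : Type} [Field K] (δ : Der K) (p e : ℕ) : K → K :=
  (δ.Vp p)^[e]

/-- A realization of the differential polynomial ring `R = K[t;δ]`: a ring `R`
together with an embedding `i : K → R` and an element `t` satisfying the
twist relation `t·a = a·t + δ(a)`, such that every element of `R` is *uniquely*
a left `K`-linear combination of the powers `t^n` (witnessed by the coefficient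
function `coeff`), and such that `R` admits a right division algorithm. -/
structure DiffPolyRing (K : Type) [Field K] (δ : Der K) (R : Type) [Ring R] where
  i : K →+* R
  t : R
  coeff : R → (ℕ →₀ K)
  t_mul : ∀ a : K, t * i a = i a * t + i (δ.toFun a)
  repr' : ∀ x : R, x = (coeff x).sum fun n a => i a * t ^ n
  coeff_unique : ∀ (x : R) (c : ℕ →₀ K), x = (c.sum fun n a => i a * t ^ n) → c = coeff x
  rightDiv : ∀ f x : R, f ≠ 0 → ∃! r : R,
    (∃ q : R, x = q * f + r) ∧ (coeff r).support.max < (coeff f).support.max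

namespace DiffPolyRing

variable {K : Type} [Field K] {δ : Der K} {R : Type} [Ring R]

/-- The degree of a differential polynomial, with `deg 0 = ⊥`. -/
def deg (D : DiffPolyRing K δ R) (x : R) : WithBot ℕ := (D.coeff x).support.max

lemma coeff_zero (D : DiffPolyRing K δ R) : D.coeff 0 = 0 :=
  (D.coeff_unique 0 0 (by simp)).symm

lemma deg_zero (D : DiffPolyRing K δ R) : D.deg 0 = ⊥ := by
  simp [deg, D.coeff_zero]

lemma coeff_add (D : DiffPolyRing K δ R) (x y : R) :
    D.coeff (x + y) = D.coeff x + D.coeff y := by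
  refine (D.coeff_unique _ _ ?_).symm
  rw [Finsupp.sum_add_index' (by simp) (by intro n a b; rw [map_add, add_mul])]
  conv_lhs => rw [D.repr' x, D.repr' y]

lemma coeff_neg (D : DiffPolyRing K δ R) (x : R) : D.coeff (-x) = -D.coeff x := by
  have h := D.coeff_add (-x) x
  rw [neg_add_cancel, D.coeff_zero] at h
  exact eq_neg_of_add_eq_zero_left h.symm

lemma deg_neg (D : DiffPolyRing K δ R) (x : R) : D.deg (-x) = D.deg x := by
  simp [deg, D.coeff_neg]

lemma deg_add_lt (D : DiffPolyRing K δ R) {x y : R} {n : WithBot ℕ}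
    (hx : D.deg x < n) (hy : D.deg y < n) : D.deg (x + y) < n := by
  have hsub : (D.coeff (x + y)).support ⊆ (D.coeff x).support ∪ (D.coeff y).support := by
    rw [D.coeff_add]; exact Finsupp.support_add
  calc D.deg (x + y) ≤ ((D.coeff x).support ∪ (D.coeff y).support).max :=
        Finset.max_mono hsub
    _ = max (D.deg x) (D.deg y) := Finset.max_union
    _ < n := max_lt hx hy

lemma coeff_smul (D : DiffPolyRing K δ R) (c : K) (x : R) :
    D.coeff (D.i c * x) = c • D.coeff x := by
  refine (D.coeff_unique _ _ ?_).symm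
  rw [Finsupp.sum_smul_index (by simp)]
  conv_lhs => rw [D.repr' x, Finsupp.mul_sum]
  exact Finsupp.sum_congr fun n _ => by rw [← mul_assoc, ← map_mul]

lemma deg_i_mul_lt (D : DiffPolyRing K δ R) (c : K) {x : R} {n : WithBot ℕ}
    (hx : D.deg x < n) : D.deg (D.i c * x) < n := by
  have hsub : (D.coeff (D.i c * x)).support ⊆ (D.coeff x).support := by
    rw [D.coeff_smul]; exact Finsupp.support_smul
  exact lt_of_le_of_lt (Finset.max_mono hsub) hx

/-- The additive subgroup of `R` consisting of the differential polynomials of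
degree `< m`; this is the underlying set of the Petit algebra `S_f` for `deg f = m`. -/
def res (D : DiffPolyRing K δ R) (m : ℕ) : AddSubgroup R where
  carrier := {x | D.deg x < (m : WithBot ℕ)}
  add_mem' hx hy := D.deg_add_lt hx hy
  zero_mem' := by
    show D.deg 0 < (m : WithBot ℕ)
    rw [D.deg_zero]
    exact bot_lt_iff_ne_bot.2 (by simp)
  neg_mem' {x} hx := by
    show D.deg (-x) < (m : WithBot ℕ)
    rw [D.deg_neg]; exact hx

/-- The underlying set `{g ∈ K[t;δ] | deg g < m}` of the Petit algebra `S_f`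
(for `f` of degree `m`), viewed as a subset of `R = K[t;δ]`. -/
def SfSet (D : DiffPolyRing K δ R) (m : ℕ) : Set R := {x | D.deg x < (m : WithBot ℕ)}

/-- The underlying `F`-vector space of the Petit algebra `S_f`, for `f` of degree `m`. -/
abbrev Rlt (D : DiffPolyRing K δ R) (m : ℕ) : Type := ↥(D.res m)

instance instSMul {F : Type} [Field F] [Algebra F K] (D : DiffPolyRing K δ R) (m : ℕ) :
    SMul F (D.Rlt m) :=
  ⟨fun c x => ⟨D.i (algebraMap F K c) * (x : R), D.deg_i_mul_lt _ x.2⟩⟩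

lemma smul_coe {F : Type} [Field F] [Algebra F K] (D : DiffPolyRing K δ R) (m : ℕ)
    (c : F) (x : D.Rlt m) : ((c • x : D.Rlt m) : R) = D.i (algebraMap F K c) * (x : R) := rfl

/-- The `F`-vector space structure of the Petit algebra (where `F ⊆ K` is the field
of constants): `c • x = i(c)·x`. -/
instance instModule {F : Type} [Field F] [Algebra F K] (D : DiffPolyRing K δ R) (m : ℕ) :
    Module F (D.Rlt m) where
  one_smul x := Subtype.ext <| by rw [smul_coe]; simp
  mul_smul a b x := Subtype.ext <| by rw [smul_coe, smul_coe, smul_coe]; simp [mul_assoc]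
  smul_zero a := Subtype.ext <| by rw [smul_coe]; simp
  smul_add a x y := Subtype.ext <| by
    rw [smul_coe]
    push_cast
    rw [smul_coe, smul_coe, mul_add]
  add_smul a b x := Subtype.ext <| by
    push_cast
    rw [smul_coe, smul_coe, smul_coe]
    simp [add_mul]
  zero_smul x := Subtype.ext <| by rw [smul_coe]; simp

open Classical in
/-- The remainder `mod_r f` of right division by `f`. -/
noncomputable def modr (D : DiffPolyRing K δ R) (f x : R) : R :=
  if h : ∃! r : R, (∃ q : R, x = q * f + r) ∧
      (D.coeff r).support.max < (D.coeff f).support.max then h.choose else 0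

/-- The multiplication of the Petit algebra `S_f`: `g ∘ h = g·h mod_r f`. -/
noncomputable def pmul (D : DiffPolyRing K δ R) (f x y : R) : R := D.modr f (x * y)

/-- The left nucleus of the Petit algebra `S_f`, as a subset of `R`. -/
def nucl (D : DiffPolyRing K δ R) (f : R) (m : ℕ) : Set R :=
  {x ∈ D.SfSet m | ∀ y ∈ D.SfSet m, ∀ z ∈ D.SfSet m,
    D.pmul f (D.pmul f x y) z = D.pmul f x (D.pmul f y z)}

/-- The middle nucleus of the Petit algebra `S_f`, as a subset of `R`. -/
def nucm (D : DiffPolyRing K δ R) (f : R) (m : ℕ) : Set R :=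
  {x ∈ D.SfSet m | ∀ y ∈ D.SfSet m, ∀ z ∈ D.SfSet m,
    D.pmul f (D.pmul f y x) z = D.pmul f y (D.pmul f x z)}

/-- The right nucleus of the Petit algebra `S_f`, as a subset of `R`. -/
def nucr (D : DiffPolyRing K δ R) (f : R) (m : ℕ) : Set R :=
  {x ∈ D.SfSet m | ∀ y ∈ D.SfSet m, ∀ z ∈ D.SfSet m,
    D.pmul f (D.pmul f y z) x = D.pmul f y (D.pmul f z x)}

/-- The nucleus of the Petit algebra `S_f`, as a subset of `R`. -/
def nuc (D : DiffPolyRing K δ R) (f : R) (m : ℕ) : Set R :=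
  D.nucl f m ∩ D.nucm f m ∩ D.nucr f m

/-- `f` is irreducible in `K[t;δ]`: it is not a unit and admits no factorization
into two factors of strictly smaller degree. -/
def Irred (D : DiffPolyRing K δ R) (f : R) : Prop :=
  ¬IsUnit f ∧ ¬∃ g h : R, f = g * h ∧ D.deg g < D.deg f ∧ D.deg h < D.deg f

/-- The Petit algebra `S_f` is a division algebra: it is nonzero, and all left and
right multiplications by nonzero elements are bijective. -/
def IsDivisionPetit (D : DiffPolyRing K δ R) (f : R) (m : ℕ) : Prop :=
  (∃ x ∈ D.SfSet m, x ≠ 0) ∧ ∀ a ∈ D.SfSet m, a ≠ 0 →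
    Set.BijOn (fun x => D.pmul f a x) (D.SfSet m) (D.SfSet m) ∧
    Set.BijOn (fun x => D.pmul f x a) (D.SfSet m) (D.SfSet m)

/-- The unital `F`-algebra `B` realizes the right nucleus of the Petit algebra `S_f`:
there is a bijection `B ≃ Nuc_r(S_f)` preserving addition, multiplication and the
`F`-algebra structure. -/
def RightNucPresents (F : Type) [Field F] [Algebra F K] (D : DiffPolyRing K δ R)
    (f : R) (m : ℕ) (B : Type) [Ring B] [Algebra F B] : Prop :=
  ∃ φ : B ≃ (D.nucr f m),
    (∀ x y : B, ((φ (x + y) : R)) = (φ x : R) + (φ y : R)) ∧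
    (∀ x y : B, ((φ (x * y) : R)) = D.pmul f (φ x : R) (φ y : R)) ∧
    (∀ c : F, ((φ (algebraMap F B c) : R)) = D.i (algebraMap F K c))

/-- A subset `S` of an `F`-vector space has dimension `d`: it contains `d` linearly
independent vectors whose span contains `S`. -/
def SetDim (F : Type) [Field F] {M : Type} [AddCommGroup M] [Module F M]
    (S : Set M) (d : ℕ) : Prop :=
  ∃ s : Finset M, ↑s ⊆ S ∧ s.card = d ∧
    LinearIndependent F (fun x : (s : Set M) => (x : M)) ∧
    S ⊆ (Submodule.span F (s : Set M) : Set M)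

/-- `f ∈ K[t;δ]` of degree `m` is an `A`-polynomial (over the field of constants `F`),
via Amitsur's characterization: the right nucleus of `S_f` has dimension `m²` over `F`. -/
def IsAPoly (F : Type) [Field F] [Algebra F K] (D : DiffPolyRing K δ R)
    (f : R) (m : ℕ) : Prop :=
  SetDim F {x : D.Rlt m | (x : R) ∈ D.nucr f m} (m ^ 2)

/-- `f ∈ R = K[t;δ]` is bounded: there is `f* ≠ 0` such that `Rf* = f*R` is the
largest two-sided ideal of `R` contained in `Rf`. -/
def IsBounded (D : DiffPolyRing K δ R) (f : R) : Prop :=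
  ∃ fs : R, fs ≠ 0 ∧
    {x : R | ∃ r, x = r * fs} = {x : R | ∃ r, x = fs * r} ∧
    (∀ x : R, (∃ r, x = r * fs) → ∃ r, x = r * f) ∧
    ∀ J : Set R, (0 : R) ∈ J → (∀ a ∈ J, ∀ b ∈ J, a + b ∈ J) →
      (∀ r : R, ∀ a ∈ J, r * a ∈ J ∧ a * r ∈ J) →
      (∀ x ∈ J, ∃ r, x = r * f) → ∀ x ∈ J, ∃ r, x = r * fs

/-- `S_f` is a free right module of rank `n` over its right nucleus. -/
def FreeRankOverNucr (D : DiffPolyRing K δ R) (f : R) (m n : ℕ) : Prop :=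
  ∃ b : Fin n → R, (∀ j, b j ∈ D.SfSet m) ∧
    ∀ x ∈ D.SfSet m, ∃! c : Fin n → (D.nucr f m),
      x = ∑ j, D.pmul f (b j) ((c j : R))

/-- The Petit algebra `S_f` is unital with unit `1 ∈ K[t;δ]`. -/
def PetitUnital (D : DiffPolyRing K δ R) (f : R) (m : ℕ) : Prop :=
  (1 : R) ∈ D.SfSet m ∧ ∀ x ∈ D.SfSet m, D.pmul f 1 x = x ∧ D.pmul f x 1 = x

end DiffPolyRing

section ConicFunctionField

open Polynomial

attribute [local instance] FractionRing.liftAlgebra in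
theorem formallyEtale_of_isAlgebraic {F A K : Type} [Field F] [CharZero F] [CommRing A]
    [IsDomain A] [Algebra F A] [Field K] [Algebra A K]
    (hinj : Function.Injective (algebraMap A K)) [Algebra.IsAlgebraic A K] :
    Algebra.FormallyEtale A K := by
  have : FaithfulSMul A K := (faithfulSMul_iff_algebraMap_injective A K).2 hinj
  have : Algebra.IsAlgebraic (FractionRing A) K :=
    (IsFractionRing.comap_isAlgebraic_iff (A := A)).1 inferInstance
  have : CharZero (FractionRing A) := charZero_of_injective_algebraMap (algebraMap F _).injective
  have : Algebra.FormallyEtale A (FractionRing A) :=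
    Algebra.FormallyEtale.of_isLocalization (nonZeroDivisors A)
  have : Algebra.FormallyEtale (FractionRing A) K := Algebra.FormallyEtale.of_isSeparable _ _
  exact Algebra.FormallyEtale.comp A (FractionRing A) K

variable {K : Type} [Field K] [Algebra ℝ K] {x y : K}

theorem isAlgebraic_of_conic (hconic : x ^ 2 + y ^ 2 + 1 = 0)
    (hgen : IntermediateField.adjoin ℝ {x, y} = ⊤) {A : Type} [CommRing A] [IsDomain A]
    [Algebra ℝ A] [Algebra A K] [IsScalarTower ℝ A K] {a : A} (ha : algebraMap A K a = x) :
    Algebra.IsAlgebraic A K := by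
  have hxA : IsAlgebraic A x := ha ▸ isAlgebraic_algebraMap a
  have hyA : IsAlgebraic A y := by
    refine IsAlgebraic.of_pow two_pos ?_
    have h : y ^ 2 = algebraMap A K (-(a ^ 2) - 1) := by
      simp only [map_sub, map_neg, map_pow, map_one, ha]
      linear_combination hconic
    exact h ▸ isAlgebraic_algebraMap _
  refine ⟨fun z => ?_⟩
  have hz : z ∈ IntermediateField.adjoin ℝ {x, y} := hgen ▸ IntermediateField.mem_top
  induction hz using IntermediateField.adjoin_induction with
  | mem w hw =>
    rcases hw with rfl | rfl
    exacts [hxA, hyA]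
  | algebraMap r =>
    rw [IsScalarTower.algebraMap_apply ℝ A K]
    exact isAlgebraic_algebraMap _
  | add _ _ _ _ h₁ h₂ => exact h₁.add h₂
  | inv _ _ h => exact h.inv
  | mul _ _ _ _ h₁ h₂ => exact h₁.mul h₂

theorem exists_derivation_of_conic (hconic : x ^ 2 + y ^ 2 + 1 = 0) (hx : Transcendental ℝ x)
    (hgen : IntermediateField.adjoin ℝ {x, y} = ⊤) (v : K) :
    ∃ d : Derivation ℝ K K, d x = v := by
  let : Algebra ℝ[X] K := (aeval x).toAlgebra
  have : IsScalarTower ℝ ℝ[X] K := IsScalarTower.of_algebraMap_eq fun r =>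
    ((aeval x).commutes r).symm
  have hX : algebraMap ℝ[X] K X = x := aeval_X x
  have := isAlgebraic_of_conic hconic hgen hX
  have : Algebra.FormallyEtale ℝ[X] K :=
    formallyEtale_of_isAlgebraic (F := ℝ) (transcendental_iff_injective.1 hx)
  let e := KaehlerDifferential.tensorKaehlerEquivOfFormallyEtale ℝ ℝ[X] K
  let d₀ : Derivation ℝ ℝ[X] K := mkDerivation ℝ v
  let l : K ⊗[ℝ[X]] Ω[ℝ[X]⁄ℝ] →ₗ[K] K :=
    LinearMap.liftBaseChange K d₀.liftKaehlerDifferential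
  refine ⟨KaehlerDifferential.linearMapEquivDerivation ℝ K (l ∘ₗ e.symm.toLinearMap), ?_⟩
  change l (e.symm (KaehlerDifferential.D ℝ K x)) = v
  rw [← hX, KaehlerDifferential.tensorKaehlerEquivOfFormallyEtale_symm_D_algebraMap]
  simp [l, d₀]

theorem exists_polynomial_repr_of_conic (hconic : x ^ 2 + y ^ 2 + 1 = 0)
    (hy : y ∉ IntermediateField.adjoin ℝ {x})
    (hgen : IntermediateField.adjoin ℝ {x, y} = ⊤) (z : K) :
    ∃ a b c : ℝ[X], aeval x c ≠ 0 ∧ z * aeval x c = aeval x a + aeval x b * y := by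
  have hz : z ∈ IntermediateField.adjoin ℝ {x, y} := hgen ▸ IntermediateField.mem_top
  induction hz using IntermediateField.adjoin_induction with
  | mem w hw =>
    rcases hw with rfl | rfl
    · exact ⟨X, 0, 1, by simp, by simp⟩
    · exact ⟨0, 1, 1, by simp, by simp⟩
  | algebraMap r => exact ⟨C r, 0, 1, by simp, by simp⟩
  | add u v _ _ h₁ h₂ =>
    obtain ⟨a, b, c, hc, h⟩ := h₁
    obtain ⟨a', b', c', hc', h'⟩ := h₂
    refine ⟨a * c' + a' * c, b * c' + b' * c, c * c', by simp [hc, hc'], ?_⟩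
    simp only [map_mul, map_add]
    linear_combination aeval x c' * h + aeval x c * h'
  | mul u v _ _ h₁ h₂ =>
    obtain ⟨a, b, c, hc, h⟩ := h₁
    obtain ⟨a', b', c', hc', h'⟩ := h₂
    refine ⟨a * a' - b * b' * (X ^ 2 + 1), a * b' + a' * b, c * c', by simp [hc, hc'], ?_⟩
    simp only [map_mul, map_add, map_sub, map_pow, map_one, aeval_X]
    linear_combination v * aeval x c' * h + (aeval x a + aeval x b * y) * h' +
      aeval x b * aeval x b' * hconic
  | inv u _ h₁ =>
    obtain ⟨a, b, c, hc, h⟩ := h₁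
    by_cases hu : u = 0
    · exact ⟨0, 0, 1, by simp, by simp [hu]⟩
    have h1 : aeval x a + aeval x b * y ≠ 0 := h ▸ mul_ne_zero hu hc
    have h2 : aeval x a - aeval x b * y ≠ 0 := by
      intro h0
      by_cases hb : aeval x b = 0
      · rw [hb] at h0 h1
        exact h1 (by linear_combination h0)
      · apply hy
        have hyx : y = aeval x a / aeval x b := by
          field_simp
          linear_combination -h0
        rw [hyx]
        have hmem (p : ℝ[X]) : aeval x p ∈ IntermediateField.adjoin ℝ {x} :=
          IntermediateField.algebra_adjoin_le_adjoin ℝ _ (aeval_mem_adjoin_singleton ℝ x)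
        exact div_mem (hmem a) (hmem b)
    have h3 : aeval x (a ^ 2 + b ^ 2 * (X ^ 2 + 1)) =
        (aeval x a + aeval x b * y) * (aeval x a - aeval x b * y) := by
      simp only [map_mul, map_add, map_pow, map_one, aeval_X]
      linear_combination aeval x b ^ 2 * hconic
    refine ⟨c * a, - (c * b), a ^ 2 + b ^ 2 * (X ^ 2 + 1), h3 ▸ mul_ne_zero h1 h2, ?_⟩
    rw [h3, ← h]
    simp only [map_mul, map_neg]
    field_simp
    ring

theorem X_sq_add_one_mul_sq_ne_sq {b c : ℝ[X]} (hc : c ≠ 0) : (X ^ 2 + 1) * b ^ 2 ≠ c ^ 2 := by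
  intro h
  have h' : (X - C Complex.I) * ((X + C Complex.I) * (b.map Complex.ofRealHom) ^ 2) =
      (c.map Complex.ofRealHom) ^ 2 := by
    have hm := congrArg (Polynomial.map Complex.ofRealHom) h
    have hI : (C Complex.I * C Complex.I : ℂ[X]) = -1 := by
      rw [← C_mul, Complex.I_mul_I]; simp
    simp only [Polynomial.map_mul, Polynomial.map_add, Polynomial.map_pow, Polynomial.map_X,
      Polynomial.map_one] at hm
    linear_combination hm - (b.map Complex.ofRealHom) ^ 2 * hI
  have hc' : (c.map Complex.ofRealHom) ≠ 0 := by
    rwa [Ne, Polynomial.map_eq_zero]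
  have hne : (c.map Complex.ofRealHom) ^ 2 ≠ 0 := pow_ne_zero 2 hc'
  have hr := congrArg (rootMultiplicity Complex.I) h'
  rw [← h'] at hne
  rw [rootMultiplicity_mul hne, rootMultiplicity_mul (right_ne_zero_of_mul hne),
    rootMultiplicity_X_sub_C_self, rootMultiplicity_eq_zero, pow_two, rootMultiplicity_mul,
    pow_two, rootMultiplicity_mul (mul_ne_zero hc' hc')] at hr
  · omega
  · rw [← pow_two]
    exact right_ne_zero_of_mul (right_ne_zero_of_mul hne)
  · simp [IsRoot]

theorem neg_one_ne_sq_of_conic (hconic : x ^ 2 + y ^ 2 + 1 = 0) (hx : Transcendental ℝ x)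
    (hy : y ∉ IntermediateField.adjoin ℝ {x})
    (hgen : IntermediateField.adjoin ℝ {x, y} = ⊤) (z : K) : z * z ≠ -1 := by
  intro hz
  obtain ⟨a, b, c, hc, h⟩ := exists_polynomial_repr_of_conic hconic hy hgen z
  have hinj := transcendental_iff_injective.1 hx
  have hc0 : c ≠ 0 := by rintro rfl; simp at hc
  have key : aeval x (a ^ 2 - b ^ 2 * (X ^ 2 + 1) + c ^ 2) + aeval x (2 * a * b) * y = 0 := by
    simp only [map_mul, map_add, map_pow, map_one, aeval_X, map_sub, map_ofNat]
    linear_combination -(z * aeval x c + aeval x a + aeval x b * y) * h -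
      aeval x b ^ 2 * hconic + (aeval x c) ^ 2 * hz
  have hab : aeval x (2 * a * b) = 0 := by
    by_contra hne
    apply hy
    have hyx : y = - aeval x (a ^ 2 - b ^ 2 * (X ^ 2 + 1) + c ^ 2) / aeval x (2 * a * b) := by
      rw [eq_div_iff hne]
      linear_combination key
    rw [hyx]
    have hmem (p : ℝ[X]) : aeval x p ∈ IntermediateField.adjoin ℝ {x} :=
      IntermediateField.algebra_adjoin_le_adjoin ℝ _ (aeval_mem_adjoin_singleton ℝ x)
    exact div_mem (neg_mem (hmem _)) (hmem _)
  rw [hab, zero_mul, add_zero] at key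
  have hab' : 2 * a * b = 0 := hinj (hab.trans (map_zero _).symm)
  have key' : a ^ 2 - b ^ 2 * (X ^ 2 + 1) + c ^ 2 = 0 := hinj (key.trans (map_zero _).symm)
  rcases mul_eq_zero.1 hab' with h2a | rfl
  · have ha : a = 0 := by simpa using h2a
    subst ha
    exact X_sq_add_one_mul_sq_ne_sq (b := b) hc0 (by linear_combination -key')
  · apply hc0
    refine Polynomial.funext fun r => ?_
    have := congrArg (eval r) key'
    simp at this
    simp
    nlinarith [sq_nonneg (eval r a), sq_nonneg (eval r c)]

theorem mem_range_of_isAlgebraic_of_conic (hconic : x ^ 2 + y ^ 2 + 1 = 0)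
    (hx : Transcendental ℝ x) (hy : y ∉ IntermediateField.adjoin ℝ {x})
    (hgen : IntermediateField.adjoin ℝ {x, y} = ⊤) (z : K) (hz : IsAlgebraic ℝ z) :
    ∃ c : ℝ, algebraMap ℝ K c = z := by
  let E := algebraicClosure ℝ K
  have hzE : z ∈ E := mem_algebraicClosure_iff.2 hz
  rcases Real.nonempty_algEquiv_or E with ⟨⟨e⟩⟩ | ⟨⟨e⟩⟩
  · refine ⟨e ⟨z, hzE⟩, ?_⟩
    have h := e.symm.commutes (e ⟨z, hzE⟩)
    rw [Algebra.algebraMap_self_apply, e.symm_apply_apply] at h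
    exact (congrArg (algebraMap E K) h).symm
  · refine absurd ?_
      (neg_one_ne_sq_of_conic hconic hx hy hgen (algebraMap E K (e.symm Complex.I)))
    rw [← map_mul, ← map_mul, Complex.I_mul_I]
    simp

theorem isAlgebraic_of_derivation_eq_zero (hconic : x ^ 2 + y ^ 2 + 1 = 0)
    (hgen : IntermediateField.adjoin ℝ {x, y} = ⊤) {d : Derivation ℝ K K} (hd : d ≠ 0) {z : K}
    (hz : d z = 0) : IsAlgebraic ℝ z := by
  by_contra htr
  have halg : Algebra.IsAlgebraic (Algebra.adjoin ℝ {x}) K :=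
    isAlgebraic_of_conic hconic hgen
      (a := (⟨x, Algebra.self_mem_adjoin_singleton ℝ x⟩ : Algebra.adjoin ℝ {x})) rfl
  have hle : Algebra.trdeg ℝ K ≤ 1 := by
    simpa using Algebra.IsAlgebraic.trdeg_le_cardinalMk ℝ {x}
  have hbasis : IsTranscendenceBasis ℝ fun _ : Unit => z :=
    (algebraicIndependent_unique_type_iff (x := fun _ : Unit => z).2 htr).isTranscendenceBasis_of_trdeg_le_of_finite
      (by simpa using hle)
  have := hbasis.isAlgebraic
  set A := Algebra.adjoin ℝ (Set.range fun _ : Unit => z)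
  have : Algebra.FormallyEtale A K :=
    formallyEtale_of_isAlgebraic (F := ℝ) Subtype.val_injective
  have hA : ∀ a : A, d a = 0 := by
    rintro ⟨a, ha⟩
    induction ha using Algebra.adjoin_induction with
    | mem w hw =>
      obtain ⟨_, rfl⟩ := hw
      exact hz
    | algebraMap r => exact d.map_algebraMap r
    | add u v _ _ h₁ h₂ =>
      change d (u + v) = 0
      rw [map_add]
      simp only at h₁ h₂
      rw [h₁, h₂, add_zero]
    | mul u v _ _ h₁ h₂ =>
      change d (u * v) = 0
      rw [d.leibniz]
      simp only at h₁ h₂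
      rw [h₁, h₂, smul_zero, smul_zero, add_zero]
  let d' : Derivation A K K :=
    Derivation.mk'
      { toFun := d
        map_add' := map_add d
        map_smul' := fun a k => by
          rw [Algebra.smul_def, d.leibniz, RingHom.id_apply, Algebra.smul_def]
          change (a : K) • d k + k • d (a : K) = _
          rw [hA a, smul_zero, add_zero]
          rfl } d.leibniz
  have hsub : Subsingleton (Derivation A K K) :=
    (KaehlerDifferential.linearMapEquivDerivation A K (M := K)).symm.toEquiv.subsingleton
  apply hd
  ext k
  exact congrArg (fun D : Derivation A K K => D k) (Subsingleton.elim d' 0)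

end ConicFunctionField

section QuaternionSplitting

variable {K : Type} [Field K] [Algebra ℝ K] {x y : K}

/-- The matrices `[0, -1; 1, 0]` and `[x, y; y, -x]` generate a copy of Hamilton's quaternions
whenever `x ^ 2 + y ^ 2 + 1 = 0`. -/
def conicQuaternionBasis (hconic : x ^ 2 + y ^ 2 + 1 = 0) :
    QuaternionAlgebra.Basis (Matrix (Fin 2) (Fin 2) K) (-1 : ℝ) 0 (-1) where
  i := !![0, -1; 1, 0]
  j := !![x, y; y, -x]
  k := !![-y, x; x, y]
  i_mul_i := by
    ext i j; fin_cases i <;> fin_cases j <;> simp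
  j_mul_j := by
    ext i j; fin_cases i <;> fin_cases j <;>
      simp [Matrix.mul_apply, Fin.sum_univ_two] <;> first | linear_combination hconic | ring
  i_mul_j := by
    ext i j; fin_cases i <;> fin_cases j <;> simp
  j_mul_i := by
    ext i j; fin_cases i <;> fin_cases j <;> simp

theorem nonempty_tensor_quaternion_algEquiv_matrix (hconic : x ^ 2 + y ^ 2 + 1 = 0) :
    Nonempty ((K ⊗[ℝ] Quaternion ℝ) ≃ₐ[K] Matrix (Fin 2) (Fin 2) K) := by
  have : CharZero K := charZero_of_injective_algebraMap (algebraMap ℝ K).injective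
  let q := conicQuaternionBasis hconic
  let Ψ : (K ⊗[ℝ] Quaternion ℝ) →ₐ[K] Matrix (Fin 2) (Fin 2) K :=
    Algebra.TensorProduct.lift (Algebra.ofId K _) q.liftHom fun _ _ => Algebra.commutes _ _
  obtain ⟨Q, hΨ⟩ : ∃ Q : ℝ → ℝ → ℝ → ℝ → Quaternion ℝ, ∀ (k : K) (a b c d : ℝ),
      Ψ (k ⊗ₜ Q a b c d) = k • (algebraMap ℝ _ a + b • q.i + c • q.j + d • q.k) := by
    refine ⟨fun a b c d => ⟨a, b, c, d⟩, fun k a b c d => ?_⟩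
    rw [Algebra.smul_def]
    exact Algebra.TensorProduct.lift_tmul ..
  have hsurj : Function.Surjective Ψ := by
    intro m
    let α : K := (m 0 0 + m 1 1) / 2
    let β : K := (m 1 0 - m 0 1) / 2
    let γ : K := (m 0 0 - m 1 1) / 2
    let ε : K := (m 0 1 + m 1 0) / 2
    refine ⟨α ⊗ₜ[ℝ] Q 1 0 0 0 + β ⊗ₜ[ℝ] Q 0 1 0 0 +
      (-(γ * x + ε * y)) ⊗ₜ[ℝ] Q 0 0 1 0 +
      (γ * y - ε * x) ⊗ₜ[ℝ] Q 0 0 0 1, ?_⟩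
    simp only [map_add, hΨ]
    ext i j
    fin_cases i <;> fin_cases j <;>
      simp [q, conicQuaternionBasis, α, β, γ, ε]
    · linear_combination (-(m 0 0 - m 1 1) / 2) * hconic
    · linear_combination (-(m 0 1 + m 1 0) / 2) * hconic
    · linear_combination (-(m 0 1 + m 1 0) / 2) * hconic
    · linear_combination ((m 0 0 - m 1 1) / 2) * hconic
  have hrank : Module.finrank K (K ⊗[ℝ] Quaternion ℝ) =
      Module.finrank K (Matrix (Fin 2) (Fin 2) K) := by
    rw [Module.finrank_baseChange, Quaternion.finrank_eq_four, Module.finrank_matrix]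
    simp
  have hinj : Function.Injective Ψ :=
    (LinearMap.injective_iff_surjective_of_finrank_eq_finrank (f := Ψ.toLinearMap) hrank).2 hsurj
  exact ⟨AlgEquiv.ofBijective Ψ ⟨hinj, hsurj⟩⟩

end QuaternionSplitting

namespace Der

open Polynomial

variable {K : Type} [Field K] (δ : Der K)

/-- The additive map underlying a derivation. -/
def toAddMonoidHom : K →+ K := AddMonoidHom.mk' δ.toFun δ.map_add'

@[simp] lemma toAddMonoidHom_apply (a : K) : δ.toAddMonoidHom a = δ.toFun a := rfl

lemma map_zero : δ.toFun 0 = 0 := δ.toAddMonoidHom.map_zero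

lemma map_neg (a : K) : δ.toFun (-a) = -δ.toFun a := δ.toAddMonoidHom.map_neg a

lemma map_sub (a b : K) : δ.toFun (a - b) = δ.toFun a - δ.toFun b := δ.toAddMonoidHom.map_sub a b

lemma map_one : δ.toFun 1 = 0 := by
  have h := δ.leibniz' 1 1
  rw [mul_one, one_mul, mul_one] at h
  exact left_eq_add.1 h

/-- A derivation of `K`, viewed as a differential ring structure. -/
abbrev toDifferential : Differential K :=
  ⟨Derivation.mk' δ.toAddMonoidHom.toIntLinearMap fun a b => by
    simp only [AddMonoidHom.coe_toIntLinearMap, toAddMonoidHom_apply, δ.leibniz', smul_eq_mul]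
    ring⟩

/-- The additive endomorphism `p ↦ X * p + δ(p)` of `K[X]`, where `δ` acts on coefficients:
left multiplication by `t` in `K[t;δ]`. -/
noncomputable def oreShift : AddMonoid.End K[X] :=
  letI := δ.toDifferential
  AddMonoidHom.mulLeft X + (Differential.mapCoeffs (A := K)).toLinearMap.toAddMonoidHom

lemma coeff_oreShift_zero (p : K[X]) : (δ.oreShift p).coeff 0 = δ.toFun (p.coeff 0) := by
  change (X * p + _).coeff 0 = _
  rw [coeff_add, coeff_X_mul_zero, zero_add]
  rfl

lemma coeff_oreShift_succ (p : K[X]) (n : ℕ) :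
    (δ.oreShift p).coeff (n + 1) = p.coeff n + δ.toFun (p.coeff (n + 1)) := by
  change (X * p + _).coeff (n + 1) = _
  rw [coeff_add, coeff_X_mul]
  rfl

lemma oreShift_smul (a : K) (p : K[X]) :
    δ.oreShift (a • p) = a • δ.oreShift p + δ.toFun a • p := by
  ext n
  cases n with
  | zero =>
    simp only [coeff_oreShift_zero, coeff_smul, coeff_add, smul_eq_mul, δ.leibniz']
  | succ n =>
    simp only [coeff_oreShift_succ, coeff_smul, coeff_add, smul_eq_mul, δ.leibniz']
    ring

lemma oreShift_X_pow (n : ℕ) : δ.oreShift (X ^ n) = X ^ (n + 1) := by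
  ext m
  have h (k : ℕ) : δ.toFun ((X ^ n : K[X]).coeff k) = 0 := by
    rw [coeff_X_pow]
    split_ifs
    exacts [δ.map_one, δ.map_zero]
  cases m with
  | zero => rw [coeff_oreShift_zero, h]; simp [coeff_X_pow]
  | succ m => rw [coeff_oreShift_succ, h]; simp [coeff_X_pow]

lemma oreShift_pow_one (n : ℕ) : (δ.oreShift ^ n) 1 = X ^ n := by
  induction n with
  | zero => simp
  | succ n ih =>
    rw [pow_succ']
    change δ.oreShift ((δ.oreShift ^ n) 1) = _
    rw [ih, oreShift_X_pow]

lemma natDegree_oreShift {p : K[X]} (hp : p ≠ 0) :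
    (δ.oreShift p).natDegree = p.natDegree + 1 ∧
      (δ.oreShift p).leadingCoeff = p.leadingCoeff := by
  have hc : (δ.oreShift p).coeff (p.natDegree + 1) = p.leadingCoeff := by
    rw [coeff_oreShift_succ, coeff_eq_zero_of_natDegree_lt (Nat.lt_succ_self _), δ.map_zero,
      add_zero, leadingCoeff]
  have hd : (δ.oreShift p).natDegree = p.natDegree + 1 := by
    refine natDegree_eq_of_le_of_coeff_ne_zero (natDegree_le_iff_coeff_eq_zero.2 fun m hm => ?_)
      (hc ▸ leadingCoeff_ne_zero.2 hp)
    obtain ⟨m, rfl⟩ : ∃ k, m = k + 1 := ⟨m - 1, by omega⟩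
    rw [coeff_oreShift_succ, coeff_eq_zero_of_natDegree_lt (by omega),
      coeff_eq_zero_of_natDegree_lt (by omega), δ.map_zero, add_zero]
  exact ⟨hd, by rw [leadingCoeff, hd, hc]⟩

lemma natDegree_oreShift_pow {p : K[X]} (hp : p ≠ 0) (n : ℕ) :
    ((δ.oreShift ^ n) p).natDegree = n + p.natDegree ∧
      ((δ.oreShift ^ n) p).leadingCoeff = p.leadingCoeff := by
  induction n with
  | zero => simp
  | succ n ih =>
    have hne : (δ.oreShift ^ n) p ≠ 0 := by
      rw [← leadingCoeff_ne_zero, ih.2]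
      exact leadingCoeff_ne_zero.2 hp
    rw [pow_succ']
    change (δ.oreShift ((δ.oreShift ^ n) p)).natDegree = _ ∧
      (δ.oreShift ((δ.oreShift ^ n) p)).leadingCoeff = _
    rw [(δ.natDegree_oreShift hne).1, (δ.natDegree_oreShift hne).2, ih.1, ih.2]
    exact ⟨by ring, rfl⟩

/-- Left multiplication by scalars, as additive endomorphisms of `K[X]`. -/
noncomputable abbrev oreScalar (K : Type) [Field K] : K →+* AddMonoid.End K[X] :=
  Module.toAddMonoidEnd K K[X]

lemma oreShift_mul_oreScalar (a : K) :
    δ.oreShift * oreScalar K a = oreScalar K a * δ.oreShift + oreScalar K (δ.toFun a) := by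
  ext1 p
  exact δ.oreShift_smul a p

/-- The differential polynomial ring `K[t;δ]`, realized as additive endomorphisms of `K[X]`. -/
noncomputable def oreRing : Subring (AddMonoid.End K[X]) :=
  Subring.closure (Set.range (oreScalar K) ∪ {δ.oreShift})

lemma oreScalar_mem (a : K) : oreScalar K a ∈ δ.oreRing :=
  Subring.subset_closure (Or.inl ⟨a, rfl⟩)

lemma oreShift_mem : δ.oreShift ∈ δ.oreRing :=
  Subring.subset_closure (Or.inr rfl)

/-- The operator `∑ aₙ tⁿ` attached to a polynomial `∑ aₙ Xⁿ`. -/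
noncomputable def oreOfPoly : K[X] →+ AddMonoid.End K[X] where
  toFun p := p.sum fun n a => oreScalar K a * δ.oreShift ^ n
  map_zero' := by simp
  map_add' p q := Polynomial.sum_add_index p q _ (by simp) (by simp [add_mul])

lemma oreOfPoly_apply (p : K[X]) :
    δ.oreOfPoly p = p.sum fun n a => oreScalar K a * δ.oreShift ^ n := rfl

lemma oreOfPoly_monomial (n : ℕ) (a : K) :
    δ.oreOfPoly (monomial n a) = oreScalar K a * δ.oreShift ^ n := by
  rw [oreOfPoly_apply, Polynomial.sum_monomial_index _ _ (by simp)]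

lemma oreShift_monomial (n : ℕ) (a : K) :
    δ.oreShift (monomial n a) = monomial (n + 1) a + monomial n (δ.toFun a) := by
  rw [← mul_one a, ← smul_eq_mul, ← smul_monomial, ← X_pow_eq_monomial, oreShift_smul,
    oreShift_X_pow]
  simp [X_pow_eq_monomial, smul_monomial]

lemma mul_oreOfPoly {φ : AddMonoid.End K[X]} (hφ : φ ∈ δ.oreRing) (p : K[X]) :
    φ * δ.oreOfPoly p = δ.oreOfPoly (φ p) := by
  induction hφ using Subring.closure_induction generalizing p with
  | mem φ h =>
    induction p using Polynomial.induction_on' with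
    | add p q hp hq => rw [_root_.map_add, mul_add, hp, hq, _root_.map_add, _root_.map_add]
    | monomial n a =>
      rcases h with ⟨b, rfl⟩ | rfl
      · rw [oreOfPoly_monomial, ← mul_assoc, ← map_mul]
        change _ = δ.oreOfPoly (b • monomial n a)
        rw [smul_monomial, oreOfPoly_monomial, smul_eq_mul]
      · rw [oreOfPoly_monomial, oreShift_monomial, _root_.map_add, oreOfPoly_monomial,
          oreOfPoly_monomial, ← mul_assoc, oreShift_mul_oreScalar, add_mul, mul_assoc, pow_succ']
  | zero => rw [zero_mul, AddMonoid.End.zero_apply, _root_.map_zero]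
  | one => rw [one_mul, AddMonoid.End.one_apply]
  | add φ ψ _ _ h₁ h₂ => 
    rw [add_mul, h₁, h₂, ← _root_.map_add]
    rfl
  | neg φ _ h => 
    refine eq_neg_of_add_eq_zero_left (a := -φ * _) (b := φ * δ.oreOfPoly p) ?_ |>.trans ?_
    · rw [← add_mul, neg_add_cancel, zero_mul]
    · rw [h, ← _root_.map_neg]
      rfl
  | mul φ ψ _ _ h₁ h₂ => 
    rw [mul_assoc, h₂, h₁]
    rfl

lemma eq_oreOfPoly {φ : AddMonoid.End K[X]} (hφ : φ ∈ δ.oreRing) : φ = δ.oreOfPoly (φ 1) := by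
  have h1 : δ.oreOfPoly 1 = 1 := by
    rw [← monomial_zero_one, oreOfPoly_monomial, _root_.map_one, pow_zero, one_mul]
  rw [← δ.mul_oreOfPoly hφ, h1, mul_one]

lemma eq_zero_of_apply_one {φ : AddMonoid.End K[X]} (hφ : φ ∈ δ.oreRing) (h : φ 1 = 0) :
    φ = 0 := by
  rw [δ.eq_oreOfPoly hφ, h, _root_.map_zero]

lemma degree_le_degree_apply {φ : AddMonoid.End K[X]} (hφ : φ ∈ δ.oreRing) (h0 : φ ≠ 0)
    (g : K[X]) : g.degree ≤ (φ g).degree := by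
  by_cases hg : g = 0
  · simp [hg]
  set p := φ 1
  have hp : p ≠ 0 := fun h => h0 (δ.eq_zero_of_apply_one hφ h)
  have hφg : φ g = ∑ n ∈ p.support, p.coeff n • (δ.oreShift ^ n) g := by
    rw [δ.eq_oreOfPoly hφ, oreOfPoly_apply, Polynomial.sum]
    exact AddMonoidHom.finsetSum_apply _ _ _
  have hc : (φ g).coeff (p.natDegree + g.natDegree) = p.leadingCoeff * g.leadingCoeff := by
    rw [hφg, finsetSum_coeff, Finset.sum_eq_single p.natDegree]
    · rw [coeff_smul, ← (δ.natDegree_oreShift_pow hg p.natDegree).1]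
      change p.leadingCoeff • leadingCoeff _ = _
      rw [(δ.natDegree_oreShift_pow hg p.natDegree).2, smul_eq_mul]
    · intro n hn hne
      have hlt : n < p.natDegree := lt_of_le_of_ne (le_natDegree_of_mem_supp n hn) hne
      have hz : ((δ.oreShift ^ n) g).coeff (p.natDegree + g.natDegree) = 0 :=
        coeff_eq_zero_of_natDegree_lt (by rw [(δ.natDegree_oreShift_pow hg n).1]; omega)
      rw [coeff_smul, hz, smul_zero]
    · intro h
      exact absurd (natDegree_mem_support_of_nonzero hp) h
  have hle := le_degree_of_ne_zero
    (hc ▸ mul_ne_zero (leadingCoeff_ne_zero.2 hp) (leadingCoeff_ne_zero.2 hg))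
  rw [degree_eq_natDegree hg]
  exact le_trans (by exact_mod_cast Nat.le_add_left _ _) hle

lemma exists_quotient_remainder {f : AddMonoid.End K[X]} (hf : f ∈ δ.oreRing) (hf0 : f ≠ 0)
    {φ : AddMonoid.End K[X]} (hφ : φ ∈ δ.oreRing) :
    ∃ q ∈ δ.oreRing, ∃ r ∈ δ.oreRing, φ = q * f + r ∧ (r 1).degree < (f 1).degree := by
  set g := f 1 with hg
  have hg0 : g ≠ 0 := fun h => hf0 (δ.eq_zero_of_apply_one hf h)
  induction hd : (φ 1).degree using WellFoundedLT.induction generalizing φ with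
  | ind d ih =>
    subst hd
    by_cases hlt : (φ 1).degree < g.degree
    · exact ⟨0, zero_mem _, φ, hφ, by simp, hlt⟩
    rw [not_lt] at hlt
    have hφ0 : φ 1 ≠ 0 := by
      intro h
      rw [h, degree_zero, le_bot_iff, degree_eq_bot] at hlt
      exact hg0 hlt
    set n := (φ 1).natDegree - g.natDegree
    have hn : n + g.natDegree = (φ 1).natDegree :=
      Nat.sub_add_cancel (natDegree_le_natDegree hlt)
    set c := (φ 1).leadingCoeff / g.leadingCoeff
    have hgl : g.leadingCoeff ≠ 0 := leadingCoeff_ne_zero.2 hg0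
    have hc0 : c ≠ 0 := div_ne_zero (leadingCoeff_ne_zero.2 hφ0) hgl
    set q₀ := oreScalar K c * δ.oreShift ^ n
    have hq₀ : q₀ ∈ δ.oreRing := mul_mem (δ.oreScalar_mem c) (pow_mem δ.oreShift_mem n)
    have happ : (q₀ * f) 1 = c • (δ.oreShift ^ n) g := rfl
    have hlead : ((q₀ * f) 1).leadingCoeff = (φ 1).leadingCoeff := by
      rw [happ, smul_eq_C_mul, leadingCoeff_mul, leadingCoeff_C,
        (δ.natDegree_oreShift_pow hg0 n).2]
      exact div_mul_cancel₀ _ hgl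
    have hne : (q₀ * f) 1 ≠ 0 := by
      rw [← leadingCoeff_ne_zero, hlead]
      exact leadingCoeff_ne_zero.2 hφ0
    have hnat : ((q₀ * f) 1).natDegree = (φ 1).natDegree := by
      rw [happ, natDegree_smul _ hc0, (δ.natDegree_oreShift_pow hg0 n).1, hn]
    have hdeg : (φ 1).degree = ((q₀ * f) 1).degree := by
      rw [degree_eq_natDegree hφ0, degree_eq_natDegree hne, hnat]
    obtain ⟨q, hq, r, hr, h, hrd⟩ := ih _ (degree_sub_lt_left hdeg hφ0 hlead.symm)
      (sub_mem hφ (mul_mem hq₀ hf)) rfl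
    refine ⟨q + q₀, add_mem hq hq₀, r, hr, ?_, hrd⟩
    rw [add_mul, add_right_comm, ← h, sub_add_cancel]

/-- The coefficients of a polynomial, as a finitely supported function. -/
def polyCoeff (p : K[X]) : ℕ →₀ K := ⟨p.support, p.coeff, fun _ => mem_support_iff⟩

/-- Every derivation admits a differential polynomial ring. -/
noncomputable def diffPolyRing : DiffPolyRing K δ δ.oreRing where
  i := (oreScalar K).codRestrict δ.oreRing δ.oreScalar_mem
  t := ⟨δ.oreShift, δ.oreShift_mem⟩
  coeff φ := polyCoeff (φ.1 1)
  t_mul a := Subtype.ext (δ.oreShift_mul_oreScalar a)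
  repr' φ := by
    refine Subtype.ext ((δ.eq_oreOfPoly φ.2).trans ?_)
    rw [oreOfPoly_apply, Polynomial.sum, Finsupp.sum, AddSubmonoidClass.coe_finsetSum]
    rfl
  coeff_unique φ c h := by
    have h1 : φ.1 1 = ∑ n ∈ c.support, c n • (X ^ n : K[X]) := by
      rw [h, Finsupp.sum, AddSubmonoidClass.coe_finsetSum]
      refine (AddMonoidHom.finsetSum_apply _ _ _).trans (Finset.sum_congr rfl fun n _ => ?_)
      rw [← δ.oreShift_pow_one n]
      rfl
    ext n
    change c n = (φ.1 1).coeff n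
    rw [h1, finsetSum_coeff]
    simp [coeff_X_pow]
  rightDiv f φ hf := by
    have hf0 : f.1 ≠ 0 := fun h => hf (Subtype.ext h)
    obtain ⟨q, hq, r, hr, h, hd⟩ := δ.exists_quotient_remainder f.2 hf0 φ.2
    refine ⟨⟨r, hr⟩, ⟨⟨⟨q, hq⟩, Subtype.ext h⟩, hd⟩, ?_⟩
    rintro s ⟨⟨q', h'⟩, hs⟩
    replace hs : (s.1 1).degree < (f.1 1).degree := hs
    have h'' : φ.1 = q'.1 * f.1 + s.1 := congrArg Subtype.val h'
    have hdiff : (q'.1 - q) * f.1 = r - s.1 := by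
      rw [sub_mul, sub_eq_sub_iff_add_eq_add, ← h'', add_comm, h, add_comm]
    have happ : (q'.1 - q) (f.1 1) = r 1 - s.1 1 :=
      congrArg (fun ψ : AddMonoid.End K[X] => ψ 1) hdiff
    have hzero : q'.1 - q = 0 := by
      by_contra hne
      refine absurd (δ.degree_le_degree_apply (sub_mem q'.2 hq) hne (f.1 1)) (not_le.2 ?_)
      rw [happ]
      exact lt_of_le_of_lt (degree_sub_le _ _) (max_lt hd hs)
    rw [hzero, zero_mul] at hdiff
    exact Subtype.ext (sub_eq_zero.1 hdiff.symm).symm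

end Der

namespace DiffPolyRing

section Quadratic

variable {K : Type} [Field K] {δ : Der K} {R : Type} [Ring R] (D : DiffPolyRing K δ R)

/-- The differential polynomial `a + b t`. -/
def lin (a b : K) : R := D.i a + D.i b * D.t

/-- The differential polynomial `t² + e`. -/
def quad (e : K) : R := D.t ^ 2 + D.i e

lemma coeff_lin (a b : K) : D.coeff (D.lin a b) = Finsupp.single 0 a + Finsupp.single 1 b := by
  refine (D.coeff_unique _ _ ?_).symm
  rw [Finsupp.sum_add_index' (by simp) (by intro n a b; rw [map_add, add_mul]),
    Finsupp.sum_single_index (by simp), Finsupp.sum_single_index (by simp)]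
  simp [lin]

lemma coeff_quad (e : K) : D.coeff (D.quad e) = Finsupp.single 0 e + Finsupp.single 2 1 := by
  refine (D.coeff_unique _ _ ?_).symm
  rw [Finsupp.sum_add_index' (by simp) (by intro n a b; rw [map_add, add_mul]),
    Finsupp.sum_single_index (by simp), Finsupp.sum_single_index (by simp)]
  simp [quad, add_comm]

lemma deg_lin_lt (a b : K) : D.deg (D.lin a b) < (2 : ℕ) := by
  rw [deg, Finset.max_eq_sup_coe, Finset.sup_lt_iff (WithBot.bot_lt_coe 2), coeff_lin]
  intro n hn
  by_contra hlt
  have h2 : 2 ≤ n := WithBot.coe_le_coe.1 (not_lt.1 hlt)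
  refine Finsupp.mem_support_iff.1 hn ?_
  rw [Finsupp.add_apply, Finsupp.single_eq_of_ne (by omega), Finsupp.single_eq_of_ne (by omega),
    add_zero]

lemma deg_quad (e : K) : D.deg (D.quad e) = (2 : ℕ) := by
  rw [deg, coeff_quad]
  refine le_antisymm (Finset.max_le fun n hn => ?_) (Finset.le_max ?_)
  · by_contra hlt
    have h2 : 2 < n := WithBot.coe_lt_coe.1 (not_le.1 hlt)
    refine Finsupp.mem_support_iff.1 hn ?_
    rw [Finsupp.add_apply, Finsupp.single_eq_of_ne (by omega), Finsupp.single_eq_of_ne (by omega),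
      add_zero]
  · simp

lemma lin_inj {a b c d : K} (h : D.lin a b = D.lin c d) : a = c ∧ b = d := by
  have hc := congrArg D.coeff h
  rw [coeff_lin, coeff_lin] at hc
  exact ⟨by simpa using DFunLike.congr_fun hc 0, by simpa using DFunLike.congr_fun hc 1⟩

lemma eq_lin {w : R} (hw : D.deg w < (2 : ℕ)) : w = D.lin (D.coeff w 0) (D.coeff w 1) := by
  have hsub : (D.coeff w).support ⊆ Finset.range 2 := by
    intro n hn
    have := lt_of_le_of_lt (Finset.le_max hn) hw
    exact Finset.mem_range.2 (WithBot.coe_lt_coe.1 this)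
  conv_lhs => rw [D.repr' w, Finsupp.sum_of_support_subset _ hsub _ (by simp)]
  simp [Finset.sum_range_succ, lin]

lemma mem_sfSet_two {w : R} : w ∈ D.SfSet 2 ↔ ∃ a b, w = D.lin a b :=
  ⟨fun h => ⟨_, _, D.eq_lin h⟩, by rintro ⟨a, b, rfl⟩; exact D.deg_lin_lt a b⟩

lemma lin_mem (a b : K) : D.lin a b ∈ D.SfSet 2 := D.deg_lin_lt a b

lemma lin_zero (a : K) : D.lin a 0 = D.i a := by simp [lin]

lemma lin_add (a b c d : K) : D.lin (a + c) (b + d) = D.lin a b + D.lin c d := by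
  simp only [lin, map_add, add_mul]
  abel

lemma i_mul_lin (k a b : K) : D.i k * D.lin a b = D.lin (k * a) (k * b) := by
  simp only [lin, map_mul, mul_add, mul_assoc]

lemma modr_eq {f w q r : R} (hf : f ≠ 0) (h : w = q * f + r) (hr : D.deg r < D.deg f) :
    D.modr f w = r := by
  have H := D.rightDiv f w hf
  rw [modr, dif_pos H]
  exact (H.choose_spec.2 r ⟨⟨q, h⟩, hr⟩).symm

lemma pmul_lin (e a b c d : K) : D.pmul (D.quad e) (D.lin a b) (D.lin c d) =
    D.lin (a * c + b * δ.toFun c - b * d * e) (a * d + b * c + b * δ.toFun d) := by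
  have hne : D.quad e ≠ 0 := fun h => by
    have := D.deg_quad e
    rw [h, D.deg_zero] at this
    exact WithBot.bot_ne_coe this
  refine D.modr_eq (q := D.i (b * d)) hne ?_ (by rw [deg_quad]; exact D.deg_lin_lt _ _)
  have hc := D.t_mul c
  have hd := D.t_mul d
  simp only [lin, quad, map_add, map_sub, map_mul]
  calc _ = D.i a * D.i c + D.i a * D.i d * D.t + D.i b * (D.t * D.i c) +
        D.i b * (D.t * D.i d) * D.t := by noncomm_ring
    _ = _ := by rw [hc, hd]; noncomm_ring

lemma petitUnital_quad (e : K) : D.PetitUnital (D.quad e) 2 := by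
  have h1 : (1 : R) = D.lin 1 0 := by simp [lin]
  refine ⟨h1 ▸ D.lin_mem 1 0, fun w hw => ?_⟩
  obtain ⟨a, b, rfl⟩ := D.mem_sfSet_two.1 hw
  rw [h1, pmul_lin, pmul_lin, δ.map_one, δ.map_zero]
  constructor <;> congr 1 <;> ring

lemma nucl_quad [CharZero K] (e : K) {x : K} (hx : δ.toFun x ≠ 0) :
    D.nucl (D.quad e) 2 = Set.range D.i := by
  ext w
  constructor
  · rintro ⟨hw, h⟩
    obtain ⟨p, q, rfl⟩ := D.mem_sfSet_two.1 hw
    have := h _ (D.lin_mem 0 1) _ (D.lin_mem x 0)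
    simp only [pmul_lin, δ.map_one, δ.map_zero, δ.map_add', δ.leibniz'] at this
    have hq : 2 * q * δ.toFun x = 0 := by linear_combination -(D.lin_inj this).2
    obtain rfl : q = 0 := by simpa [hx] using hq
    exact ⟨p, (D.lin_zero p).symm⟩
  · rintro ⟨p, rfl⟩
    rw [← D.lin_zero]
    refine ⟨D.lin_mem _ _, fun Y hY Z hZ => ?_⟩
    obtain ⟨a, b, rfl⟩ := D.mem_sfSet_two.1 hY
    obtain ⟨c, d, rfl⟩ := D.mem_sfSet_two.1 hZ
    simp only [pmul_lin]
    congr 1 <;> ring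

lemma nucm_quad [CharZero K] (e : K) {x : K} (hx : δ.toFun x ≠ 0) :
    D.nucm (D.quad e) 2 = Set.range D.i := by
  ext w
  constructor
  · rintro ⟨hw, h⟩
    obtain ⟨p, q, rfl⟩ := D.mem_sfSet_two.1 hw
    have := h _ (D.lin_mem 0 1) _ (D.lin_mem x 0)
    simp only [pmul_lin, δ.map_zero, δ.map_add', δ.leibniz', mul_zero] at this
    have hq : 2 * q * δ.toFun x = 0 := by linear_combination -(D.lin_inj this).2
    obtain rfl : q = 0 := by simpa [hx] using hq
    exact ⟨p, (D.lin_zero p).symm⟩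
  · rintro ⟨p, rfl⟩
    rw [← D.lin_zero]
    refine ⟨D.lin_mem _ _, fun Y hY Z hZ => ?_⟩
    obtain ⟨a, b, rfl⟩ := D.mem_sfSet_two.1 hY
    obtain ⟨c, d, rfl⟩ := D.mem_sfSet_two.1 hZ
    simp only [pmul_lin, δ.map_zero, zero_mul, add_zero, sub_zero, mul_zero, δ.leibniz']
    congr 1 <;> ring

lemma lin_mem_nucr_quad {e : K} (he : δ.toFun e = 0) {a b : K} :
    D.lin a b ∈ D.nucr (D.quad e) 2 ↔
      δ.toFun (δ.toFun a) = 2 * e * δ.toFun b ∧ δ.toFun (δ.toFun b) = -2 * δ.toFun a := by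
  constructor
  · rintro ⟨-, h⟩
    have := h _ (D.lin_mem 0 1) _ (D.lin_mem 0 1)
    simp only [pmul_lin, δ.map_one, δ.map_zero, δ.map_add', δ.map_sub, δ.leibniz', he] at this
    obtain ⟨h1, h2⟩ := D.lin_inj this
    exact ⟨by linear_combination -h1, by linear_combination -h2⟩
  · rintro ⟨h1, h2⟩
    refine ⟨D.lin_mem _ _, fun Y hY Z hZ => ?_⟩
    obtain ⟨p, q, rfl⟩ := D.mem_sfSet_two.1 hY
    obtain ⟨r, s, rfl⟩ := D.mem_sfSet_two.1 hZ
    simp only [pmul_lin, δ.map_add', δ.map_sub, δ.leibniz', he]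
    congr 1
    · linear_combination -(q * s) * h1
    · linear_combination -(q * s) * h2

end Quadratic

theorem setDim_range {F : Type} [Field F] {V : Type*} {M : Type} [AddCommGroup V] [Module F V]
    [FiniteDimensional F V] [AddCommGroup M] [Module F M] (G : V →ₗ[F] M)
    (hG : Function.Injective G) : SetDim F (Set.range G) (Module.finrank F V) := by
  classical
  let b := Module.finBasis F V
  let s : Finset M := Finset.univ.image (G ∘ b)
  have hs : (s : Set M) = Set.range (G ∘ b) := by simp [s, Function.comp_def]
  have hli : LinearIndependent F (G ∘ b) :=
    b.linearIndependent.map' G (LinearMap.ker_eq_bot.2 hG)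
  refine ⟨s, ?_, ?_, ?_, ?_⟩
  · rw [hs]
    exact Set.range_comp_subset_range _ _
  · rw [Finset.card_image_of_injective _ (hG.comp b.injective), Finset.card_univ, Fintype.card_fin]
  · have := hli.linearIndepOn_id
    rw [← hs] at this
    exact this
  · rw [hs, Set.range_comp, Submodule.span_image, b.span_eq]
    rintro _ ⟨v, rfl⟩
    exact ⟨v, trivial, rfl⟩

section Conic

variable {K : Type} [Field K] [Algebra ℝ K] {δ : Der K} {R : Type} [Ring R]
  (D : DiffPolyRing K δ R) {x y : K}

lemma not_finiteDimensional_rlt (hx : Transcendental ℝ x) :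
    ¬FiniteDimensional ℝ (D.Rlt 2) := by
  intro hfin
  let G : K →ₗ[ℝ] D.Rlt 2 :=
    { toFun a := ⟨D.lin a 0, D.lin_mem a 0⟩
      map_add' a b := Subtype.ext <| by
        change D.lin (a + b) 0 = D.lin a 0 + D.lin b 0
        rw [← D.lin_add, add_zero]
      map_smul' c a := Subtype.ext <| by
        rw [RingHom.id_apply, smul_coe, D.i_mul_lin, mul_zero, Algebra.smul_def] }
  have hG : Function.Injective G := fun a b h => (D.lin_inj (congrArg Subtype.val h)).1
  have : FiniteDimensional ℝ K := FiniteDimensional.of_injective G hG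
  exact hx (Algebra.IsAlgebraic.isAlgebraic x)

/-- The embedding of Hamilton's quaternions into the Petit algebra of `t² + 1/4` given by
`i ↦ 2t`, `j ↦ 2xt - y`, `k ↦ 2yt + x`. -/
noncomputable def quaternionMap (x y : K) : Quaternion ℝ →ₗ[ℝ] D.Rlt 2 where
  toFun q := ⟨D.lin
    (algebraMap ℝ K q.re - algebraMap ℝ K q.imJ * y + algebraMap ℝ K q.imK * x)
    (2 * algebraMap ℝ K q.imI + 2 * algebraMap ℝ K q.imJ * x + 2 * algebraMap ℝ K q.imK * y),
    D.lin_mem _ _⟩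
  map_add' p q := Subtype.ext <| by
    change D.lin _ _ = D.lin _ _ + D.lin _ _
    rw [← D.lin_add]
    simp only [Quaternion.re_add, Quaternion.imI_add, Quaternion.imJ_add, Quaternion.imK_add,
      map_add]
    congr 1 <;> ring
  map_smul' c q := Subtype.ext <| by
    rw [RingHom.id_apply, smul_coe, D.i_mul_lin]
    simp only [Quaternion.re_smul, Quaternion.imI_smul, Quaternion.imJ_smul, Quaternion.imK_smul,
      smul_eq_mul, map_mul]
    congr 1 <;> ring

lemma coe_quaternionMap (q : Quaternion ℝ) : (D.quaternionMap x y q : R) = D.lin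
    (algebraMap ℝ K q.re - algebraMap ℝ K q.imJ * y + algebraMap ℝ K q.imK * x)
    (2 * algebraMap ℝ K q.imI + 2 * algebraMap ℝ K q.imJ * x + 2 * algebraMap ℝ K q.imK * y) :=
  rfl

lemma quaternionMap_algebraMap (c : ℝ) :
    (D.quaternionMap x y (algebraMap ℝ _ c) : R) = D.i (algebraMap ℝ K c) := by
  rw [coe_quaternionMap, ← D.lin_zero]
  simp [Quaternion.algebraMap_def]

lemma quaternionMap_injective (hδ : δ.HasConstants ℝ) (hδx : δ.toFun x = y)
    (hδy : δ.toFun y = -x) (hconic : x ^ 2 + y ^ 2 + 1 = 0) :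
    Function.Injective (D.quaternionMap x y) := by
  have : CharZero K := charZero_of_injective_algebraMap (algebraMap ℝ K).injective
  rw [injective_iff_map_eq_zero]
  intro q hq
  have hc (c : ℝ) : δ.toFun (algebraMap ℝ K c) = 0 := (hδ _).2 ⟨c, rfl⟩
  have h0 : D.lin _ _ = 0 := congrArg Subtype.val hq
  rw [show (0 : R) = D.lin 0 0 by simp [lin]] at h0
  obtain ⟨h1, h2⟩ := D.lin_inj h0
  have h3 := congrArg δ.toFun h1
  simp only [δ.map_add', δ.map_sub, δ.leibniz', hc, hδx, hδy, δ.map_zero] at h3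
  have h4 : algebraMap ℝ K q.imI = 0 := by linear_combination (h2 - 2 * h3) / 2
  have h5 := congrArg δ.toFun h3
  simp only [δ.map_add', δ.map_neg, δ.map_sub, δ.leibniz', hc, hδx, hδy, δ.map_zero] at h5
  have h6 : algebraMap ℝ K q.re = 0 := by linear_combination h1 + h5
  have h7 : algebraMap ℝ K q.imJ = 0 := by
    linear_combination -x * h3 - y * h5 + algebraMap ℝ K q.imJ * hconic
  have h8 : algebraMap ℝ K q.imK = 0 := by
    linear_combination -y * h3 + x * h5 + algebraMap ℝ K q.imK * hconic
  rw [map_eq_zero] at h4 h6 h7 h8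
  exact Quaternion.ext _ _ h6 h4 h7 h8

lemma quaternionMap_mul (hδ : δ.HasConstants ℝ) (hδx : δ.toFun x = y)
    (hδy : δ.toFun y = -x) (hconic : x ^ 2 + y ^ 2 + 1 = 0)
    (p q : Quaternion ℝ) : (D.quaternionMap x y (p * q) : R) =
    D.pmul (D.quad (1 / 4)) (D.quaternionMap x y p) (D.quaternionMap x y q) := by
  have : CharZero K := charZero_of_injective_algebraMap (algebraMap ℝ K).injective
  have hc (c : ℝ) : δ.toFun (algebraMap ℝ K c) = 0 := (hδ _).2 ⟨c, rfl⟩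
  have h2 : δ.toFun (2 : K) = 0 := by simpa only [map_ofNat] using hc 2
  simp only [coe_quaternionMap, pmul_lin, δ.map_add', δ.map_sub, δ.leibniz', hc, hδx, hδy, h2,
    Quaternion.re_mul, Quaternion.imI_mul, Quaternion.imJ_mul, Quaternion.imK_mul, map_add,
    map_sub, map_mul]
  congr 1
  · linear_combination -(algebraMap ℝ K p.imJ * algebraMap ℝ K q.imJ +
      algebraMap ℝ K p.imK * algebraMap ℝ K q.imK) * hconic
  · linear_combination 2 * (algebraMap ℝ K p.imJ * algebraMap ℝ K q.imK -
      algebraMap ℝ K p.imK * algebraMap ℝ K q.imJ) * hconic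

lemma range_quaternionMap (hδ : δ.HasConstants ℝ) (hδx : δ.toFun x = y)
    (hδy : δ.toFun y = -x) (hconic : x ^ 2 + y ^ 2 + 1 = 0) :
    Set.range (D.quaternionMap x y) = {w : D.Rlt 2 | (w : R) ∈ D.nucr (D.quad (1 / 4)) 2} := by
  have : CharZero K := charZero_of_injective_algebraMap (algebraMap ℝ K).injective
  have hc (c : ℝ) : δ.toFun (algebraMap ℝ K c) = 0 := (hδ _).2 ⟨c, rfl⟩
  have h2 : δ.toFun (2 : K) = 0 := by simpa only [map_ofNat] using hc 2
  have he : δ.toFun (1 / 4 : K) = 0 := by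
    simpa only [map_div₀, map_one, map_ofNat] using hc (1 / 4)
  ext ⟨w, hw⟩
  rw [Set.mem_ofPred_eq, Set.mem_range]
  constructor
  · rintro ⟨q, hq⟩
    have hqw : D.lin _ _ = w := congrArg Subtype.val hq
    change w ∈ _
    rw [← hqw, D.lin_mem_nucr_quad he]
    simp only [δ.map_add', δ.map_sub, δ.map_neg, δ.leibniz', hc, hδx, hδy, h2, δ.map_zero]
    constructor <;> ring
  · intro h
    change w ∈ _ at h
    obtain ⟨a, b, rfl⟩ := D.mem_sfSet_two.1 hw
    obtain ⟨h1, h3⟩ := (D.lin_mem_nucr_quad he).1 h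
    obtain ⟨c₁, hc₁⟩ := (hδ (δ.toFun a - 1 / 2 * b)).1 <| by
      have h12 : δ.toFun (1 / 2 : K) = 0 := by
        simpa only [map_div₀, map_one, map_ofNat] using hc (1 / 2)
      rw [δ.map_sub, δ.leibniz', h12]
      linear_combination h1
    have hbb : δ.toFun (δ.toFun b) = -(b + 2 * algebraMap ℝ K c₁) := by
      linear_combination h3 + 2 * hc₁
    obtain ⟨c₂, hc₂⟩ := (hδ (δ.toFun b + 2 * a)).1 <| by
      rw [δ.map_add', δ.leibniz', h2]
      linear_combination h3
    obtain ⟨w₁, hw₁⟩ := (hδ (x * δ.toFun b - y * (b + 2 * algebraMap ℝ K c₁))).1 <| by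
      simp only [δ.map_add', δ.map_sub, δ.leibniz', hc, hδx, hδy, h2, hbb]
      ring
    obtain ⟨w₂, hw₂⟩ := (hδ (y * δ.toFun b + x * (b + 2 * algebraMap ℝ K c₁))).1 <| by
      simp only [δ.map_add', δ.leibniz', hc, hδx, hδy, h2, hbb]
      ring
    refine ⟨⟨c₂ / 2, -c₁, -w₂ / 2, w₁ / 2⟩, Subtype.ext ?_⟩
    change D.lin _ _ = D.lin a b
    simp only [map_neg, map_div₀, map_ofNat]
    congr 1
    · linear_combination 1 / 2 * hc₂ + x / 2 * hw₁ + y / 2 * hw₂ + δ.toFun b / 2 * hconic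
    · linear_combination y * hw₁ - x * hw₂ - (b + 2 * algebraMap ℝ K c₁) * hconic

lemma isAPoly_quad (hδ : δ.HasConstants ℝ) (hδx : δ.toFun x = y)
    (hδy : δ.toFun y = -x) (hconic : x ^ 2 + y ^ 2 + 1 = 0) :
    D.IsAPoly ℝ (D.quad (1 / 4)) 2 := by
  have h := setDim_range _ (D.quaternionMap_injective hδ hδx hδy hconic)
  rwa [D.range_quaternionMap hδ hδx hδy hconic, Quaternion.finrank_eq_four] at h

lemma rightNucPresents_quad (hδ : δ.HasConstants ℝ) (hδx : δ.toFun x = y)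
    (hδy : δ.toFun y = -x) (hconic : x ^ 2 + y ^ 2 + 1 = 0) :
    D.RightNucPresents ℝ (D.quad (1 / 4)) 2 (Quaternion ℝ) := by
  have hr := D.range_quaternionMap hδ hδx hδy hconic
  have hinj := D.quaternionMap_injective hδ hδx hδy hconic
  let φ (q : Quaternion ℝ) : D.nucr (D.quad (1 / 4)) 2 :=
    ⟨D.quaternionMap x y q, hr.subset ⟨q, rfl⟩⟩
  have hφ : Function.Bijective φ := by
    refine ⟨fun p q h => ?_, fun ⟨w, hw⟩ => ?_⟩
    · have hval := congrArg Subtype.val h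
      exact hinj (Subtype.ext hval)
    · have hw' : (⟨w, hw.1⟩ : D.Rlt 2) ∈ Set.range (D.quaternionMap x y) := hr ▸ hw
      obtain ⟨q, hq⟩ := hw'
      have hval := congrArg Subtype.val hq
      exact ⟨q, Subtype.ext hval⟩
  refine ⟨Equiv.ofBijective φ hφ, fun p q => ?_, fun p q => ?_, D.quaternionMap_algebraMap⟩
  · exact congrArg Subtype.val (_root_.map_add (D.quaternionMap x y) p q)
  · exact D.quaternionMap_mul hδ hδx hδy hconic p q

end Conic

end DiffPolyRing

/-- Let `K` be the function field of the projective real conic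
`x² + y² + z² = 0` (characterized here as `K = ℝ(x,y)` with `x` transcendental,
`x² + y² + 1 = 0` and `y ∉ ℝ(x)`).  Then `ℝ` is algebraically closed in `K`, `K` splits
Hamilton's quaternions `(-1,-1)_ℝ`, there is a derivation `δ` on `K` with constants `ℝ`,
and there is an `A`-polynomial `f ∈ K[t;δ]` of degree `2` such that
`S_f = K[t;δ]/K[t;δ]f = K ⊕ Kt` is an infinite-dimensional unital nonassociative
`ℝ`-algebra with right nucleus isomorphic to `(-1,-1)_ℝ` and left and middle nuclei
equal to `K`. -/
theorem statement_19 (K : Type) [Field K] [Algebra ℝ K]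
    (x y : K) (hconic : x ^ 2 + y ^ 2 + 1 = 0)
    (hx : Transcendental ℝ x) (hy : y ∉ IntermediateField.adjoin ℝ {x})
    (hgen : IntermediateField.adjoin ℝ {x, y} = ⊤) :
    (∀ z : K, IsAlgebraic ℝ z → ∃ c : ℝ, algebraMap ℝ K c = z) ∧
    Nonempty ((K ⊗[ℝ] Quaternion ℝ) ≃ₐ[K] Matrix (Fin 2) (Fin 2) K) ∧
    ∃ δ : Der K, δ.HasConstants ℝ ∧
      ∃ (R : Type) (_ : Ring R) (D : DiffPolyRing K δ R) (f : R),
        D.deg f = (2 : WithBot ℕ) ∧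
        D.IsAPoly ℝ f 2 ∧
        D.PetitUnital f 2 ∧
        D.SfSet 2 = {w : R | ∃ a b : K, w = D.i a + D.i b * D.t} ∧
        ¬FiniteDimensional ℝ (D.Rlt 2) ∧
        D.RightNucPresents ℝ f 2 (Quaternion ℝ) ∧
        D.nucl f 2 = Set.range D.i ∧
        D.nucm f 2 = Set.range D.i := by
  have : CharZero K := charZero_of_injective_algebraMap (algebraMap ℝ K).injective
  have hy0 : y ≠ 0 := by
    rintro rfl
    exact hy (zero_mem _)
  obtain ⟨d, hdx⟩ := exists_derivation_of_conic hconic hx hgen y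
  have hdy : d y = -x := by
    have h := congrArg d hconic
    simp only [map_add, Derivation.leibniz_pow, Derivation.map_one_eq_zero, map_zero, hdx] at h
    have h' : 2 * y * (d y + x) = 0 := by
      simp at h
      linear_combination h
    have : d y + x = 0 := by simpa [hy0] using h'
    exact eq_neg_of_add_eq_zero_left this
  have hd0 : d ≠ 0 := by
    rintro rfl
    exact hy0 hdx.symm
  let δ : Der K := ⟨d, map_add d, fun a b => by
    rw [Derivation.leibniz, smul_eq_mul, smul_eq_mul, mul_comm b]⟩
  have hδ : δ.HasConstants ℝ := fun a =>
    ⟨fun h => mem_range_of_isAlgebraic_of_conic hconic hx hy hgen a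
      (isAlgebraic_of_derivation_eq_zero hconic hgen hd0 h), by
      rintro ⟨c, rfl⟩
      exact d.map_algebraMap c⟩
  let D := δ.diffPolyRing
  have hδx : δ.toFun x ≠ 0 := fun h => hy0 (hdx.symm.trans h)
  exact ⟨mem_range_of_isAlgebraic_of_conic hconic hx hy hgen,
    nonempty_tensor_quaternion_algEquiv_matrix hconic, δ, hδ, δ.oreRing, inferInstance, D,
    D.quad (1 / 4), D.deg_quad _, D.isAPoly_quad hδ hdx hdy hconic, D.petitUnital_quad _,
    Set.ext fun _ => D.mem_sfSet_two, D.not_finiteDimensional_rlt hx,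
    D.rightNucPresents_quad hδ hdx hdy hconic, D.nucl_quad _ hδx, D.nucm_quad _ hδx⟩
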